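/- Let m ≥ 1 and let L be a subgroup of ℤ^m of finite index n. Suppose a₁, …, a_m ∈ L are ℤ-linearly independent and each a_j is nonnegative. Then n ≤ deg(a₁)⋯deg(a_m); in particular, if deg(a_j) ≤ d for every j, then n ≤ d^m. (This is the lattice form, via the paper's dictionary, of Theorem 'Lower bound': for a finite abelian group G and a faithful non-modular representation V with m distinct nontrivial characters, γ_field(G,V) ≥ |G|^{1/m}.) -/

import Mathlib

/-- The determinant of a nonnegative matrix is at most the product of its row sums in absolute
value. -/
theorem Matrix.abs_det_le_prod_row_sum {ι R : Type*} [Fintype ι] [DecidableEq ι] [CommRing R]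
    [LinearOrder R] [IsStrictOrderedRing R] (A : Matrix ι ι R) (hA : ∀ i j, 0 ≤ A i j) :
    |A.det| ≤ ∏ i, ∑ j, A i j := by
  rw [← Matrix.det_transpose, Matrix.det_apply]
  calc |∑ σ : Equiv.Perm ι, Equiv.Perm.sign σ • ∏ i, A.transpose (σ i) i|
      ≤ ∑ σ : Equiv.Perm ι, |Equiv.Perm.sign σ • ∏ i, A.transpose (σ i) i| :=
        Finset.abs_sum_le_sum_abs _ _
    _ = ∑ σ : Equiv.Perm ι, ∏ i, A i (σ i) := by
        refine Finset.sum_congr rfl fun σ _ => ?_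
        have h : 0 ≤ ∏ i, A i (σ i) := Finset.prod_nonneg fun i _ => hA i (σ i)
        rcases Int.units_eq_one_or (Equiv.Perm.sign σ) with hs | hs <;>
          simp [hs, Matrix.transpose_apply, abs_of_nonneg h]
    _ = ∑ f ∈ Finset.univ.map ⟨fun σ : Equiv.Perm ι => (σ : ι → ι), DFunLike.coe_injective⟩,
          ∏ i, A i (f i) := by
        rw [Finset.sum_map]
        rfl
    _ ≤ ∑ f : ι → ι, ∏ i, A i (f i) :=
        Finset.sum_le_sum_of_subset_of_nonneg (Finset.subset_univ _)
          fun f _ _ => Finset.prod_nonneg fun i _ => hA i (f i)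
    _ = ∏ i, ∑ j, A i j := (Fintype.prod_sum fun i j => A i j).symm

/-- A square matrix over an integral domain with linearly independent rows has nonzero
determinant. -/
theorem Matrix.det_ne_zero_of_linearIndependent_row {ι R : Type*} [Fintype ι] [DecidableEq ι]
    [CommRing R] [IsDomain R] {A : Matrix ι ι R} (hA : LinearIndependent R A.row) :
    A.det ≠ 0 := by
  intro h
  obtain ⟨v, hv, hvA⟩ := Matrix.exists_vecMul_eq_zero_iff.mpr h
  exact hv (Matrix.vecMul_injective_iff.mpr hA (hvA.trans (Matrix.zero_vecMul A).symm))

/-- The index of a subgroup of `ℤ^ι` divides the determinant of any `ι`-indexed linearly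
independent family of its elements. -/
theorem AddSubgroup.index_dvd_natAbs_det {ι : Type*} [Fintype ι] [DecidableEq ι]
    (L : AddSubgroup (ι → ℤ)) {a : ι → ι → ℤ} (haL : ∀ j, a j ∈ L)
    (ha : LinearIndependent ℤ a) : L.index ∣ (Matrix.of a).det.natAbs := by
  have hle : (Submodule.span ℤ (Set.range a)).toAddSubgroup ≤ L := by
    change Submodule.span ℤ (Set.range a) ≤ L.toIntSubmodule
    rw [Submodule.span_le]
    rintro _ ⟨j, rfl⟩
    exact haL j
  have hdet : (Submodule.span ℤ (Set.range a)).toAddSubgroup.index =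
      (Matrix.of a).det.natAbs := by
    rw [AddSubgroup.index_eq_natAbs_det (Pi.basisFun ℤ ι) _ (Module.Basis.span ha)]
    rw [Pi.basisFun_det_apply]
    exact congrArg (fun b : ι → ι → ℤ => (Matrix.of b).det.natAbs)
      (funext fun j => congrArg Subtype.val (Module.Basis.span_apply ha j))
  exact hdet ▸ AddSubgroup.index_dvd_of_le hle


/-- Let `m ≥ 1` and let `L` be a subgroup of `ℤ^m` of finite index `n`.
If `a 0, …, a (m-1) ∈ L` are `ℤ`-linearly independent and nonnegative, then
`n ≤ deg (a 0) ⋯ deg (a (m-1))`; in particular, if every `deg (a j) ≤ d`, then `n ≤ d ^ m`. -/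
theorem stmt_0 (m n : ℕ) (hm : 1 ≤ m) (L : AddSubgroup (Fin m → ℤ))
    (hidx : L.index = n) (hn0 : n ≠ 0)
    (a : Fin m → (Fin m → ℤ)) (haL : ∀ j, a j ∈ L)
    (hind : LinearIndependent ℤ a) (hpos : ∀ j i, 0 ≤ a j i) :
    (n : ℤ) ≤ ∏ j, ∑ i, a j i ∧
      ∀ d : ℤ, (∀ j, ∑ i, a j i ≤ d) → (n : ℤ) ≤ d ^ m := by
  have hle : (n : ℤ) ≤ ∏ j, ∑ i, a j i := by
    have hdet : (Matrix.of a).det ≠ 0 := Matrix.det_ne_zero_of_linearIndependent_row hind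
    have hn : n ≤ (Matrix.of a).det.natAbs :=
      hidx ▸ Nat.le_of_dvd (Int.natAbs_pos.mpr hdet) (L.index_dvd_natAbs_det haL hind)
    calc (n : ℤ) ≤ ((Matrix.of a).det.natAbs : ℤ) := by exact_mod_cast hn
      _ = |(Matrix.of a).det| := Int.natCast_natAbs _
      _ ≤ ∏ j, ∑ i, a j i := Matrix.abs_det_le_prod_row_sum (Matrix.of a) hpos
  refine ⟨hle, fun d hd => hle.trans ?_⟩
  calc ∏ j, ∑ i, a j i ≤ ∏ _j : Fin m, d :=
        Finset.prod_le_prod (fun j _ => Finset.sum_nonneg fun i _ => hpos j i) fun j _ => hd j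
    _ = d ^ m := by simp
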